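/- Let n ≥ 2, let A be an n-qubit architecture with R gates, and let A' be an n-qubit architecture with R' gates. If the accessible dimensions satisfy d_{A'} < d_A, then the set { x ∈ SU(4)^{×R} : F^A(x) ∈ U(A') } has Haar product measure zero in SU(4)^{×R}; that is, a Haar-random architecture-A circuit implements a unitary implementable with A' with probability zero. -/

import Mathlib

open scoped Matrix ENNReal Classical Kronecker ComplexOrder
open MeasureTheory

/-! ## Basic objects: qubit bases, gates, architectures, contraction maps -/

/-- Computational-basis index set for `n` qubits. -/
abbrev QubitBasis (n : ℕ) := Fin n → Fin 2

/-- `2^n × 2^n` complex matrices, indexed by the computational basis of `n` qubits. -/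
abbrev NMatrix (n : ℕ) := Matrix (QubitBasis n) (QubitBasis n) ℂ

/-- The special unitary group `SU(4)` of two-qubit gates. -/
abbrev SU4 := Matrix.specialUnitaryGroup (Fin 4) ℂ

/-- An architecture on `n` qubits with `R` gates: a list of ordered pairs of distinct qubits. -/
def Architecture (n R : ℕ) := Fin R → {p : Fin n × Fin n // p.1 ≠ p.2}

/-- Identification of a pair of one-qubit basis indices with a two-qubit basis index. -/
def pairIdx (a b : Fin 2) : Fin 4 := ⟨2 * a.val + b.val, by omega⟩

/-- The `n`-qubit matrix given by letting the two-qubit matrix `u` act on the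
tensor factors `p.1` and `p.2`, and as the identity on all other factors. -/
noncomputable def embedGate {n : ℕ} (p : Fin n × Fin n) (u : Matrix (Fin 4) (Fin 4) ℂ) :
    NMatrix n := fun a b =>
  if (∀ i, i ≠ p.1 → i ≠ p.2 → a i = b i)
  then u (pairIdx (a p.1) (a p.2)) (pairIdx (b p.1) (b p.2)) else 0

/-- The list of `n`-qubit gates obtained by substituting the gates `x` into
the architecture `A`. -/
noncomputable def gateList {n R : ℕ} (A : Architecture n R) (x : Fin R → SU4) :
    List (NMatrix n) :=
  List.ofFn fun i => embedGate (A i).1 (x i : Matrix (Fin 4) (Fin 4) ℂ)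

/-- The contraction map `F^A` of an architecture `A`: it sends a tuple of two-qubit gates
`(u_1, …, u_R)` to the `n`-qubit unitary `(u_R)_{p_R} ⋯ (u_1)_{p_1}`. -/
noncomputable def contract {n R : ℕ} (A : Architecture n R) (x : Fin R → SU4) : NMatrix n :=
  ((gateList A x).reverse).prod

/-- The exact circuit complexity: the least number `R` of two-qubit gates, arranged in any
architecture, implementing the matrix `U`. -/
noncomputable def Cu (n : ℕ) (U : NMatrix n) : ℕ :=
  sInf {R | ∃ A : Architecture n R, ∃ x : Fin R → SU4, contract A x = U}

/-- The all-zeros computational basis state `|0^n⟩`. -/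
noncomputable def ket0 (n : ℕ) : QubitBasis n → ℂ := fun a => if a = fun _ => 0 then 1 else 0

/-- The exact state complexity: the least number `R` of two-qubit gates, arranged in any
architecture, producing `ψ` from `|0^n⟩`. -/
noncomputable def Cstate (n : ℕ) (ψ : QubitBasis n → ℂ) : ℕ :=
  sInf {R | ∃ A : Architecture n R, ∃ x : Fin R → SU4, (contract A x) *ᵥ ket0 n = ψ}

/-- The gates with indices `lo ≤ i < hi` of `A` form a causal slice with sink qubit `t`:
every qubit `q` is connected to `t` by a path through gates of the slice, taken in
increasing index order. -/
def IsCausalSliceWith {n R : ℕ} (A : Architecture n R) (lo hi : ℕ) (t : Fin n) : Prop :=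
  ∀ q : Fin n, ∃ (m : ℕ) (idx : Fin m → Fin R) (qs : Fin (m + 1) → Fin n),
    StrictMono idx ∧ (∀ l, lo ≤ (idx l : ℕ) ∧ (idx l : ℕ) < hi) ∧
    qs 0 = q ∧ qs (Fin.last m) = t ∧
    ∀ l : Fin m,
      (qs l.castSucc = (A (idx l)).1.1 ∨ qs l.castSucc = (A (idx l)).1.2) ∧
      (qs l.succ = (A (idx l)).1.1 ∨ qs l.succ = (A (idx l)).1.2)

/-- The gates with indices `lo ≤ i < hi` of `A` form a causal slice. -/
def IsCausalSlice {n R : ℕ} (A : Architecture n R) (lo hi : ℕ) : Prop :=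
  ∃ t, IsCausalSliceWith A lo hi t

/-! ## Group, topological, measurable and compactness structure on `SU(4)`,
and its Haar probability measure -/

namespace SU4

theorem star_mem {U : Matrix (Fin 4) (Fin 4) ℂ}
    (hU : U ∈ Matrix.specialUnitaryGroup (Fin 4) ℂ) :
    star U ∈ Matrix.specialUnitaryGroup (Fin 4) ℂ := by
  rw [Matrix.mem_specialUnitaryGroup_iff] at hU ⊢
  refine ⟨Unitary.star_mem hU.1, ?_⟩
  have : (star U).det = star U.det := by
    simp [Matrix.star_eq_conjTranspose, Matrix.det_conjTranspose]
  rw [this, hU.2]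
  simp

noncomputable instance : Group SU4 :=
  { (inferInstance : Monoid SU4) with
    inv := fun U => ⟨star U.1, star_mem U.2⟩
    inv_mul_cancel := fun U => Subtype.ext <| by
      have h := (Matrix.mem_specialUnitaryGroup_iff.mp U.2).1.1
      simpa using h }

instance : IsTopologicalGroup SU4 where
  continuous_mul := by
    apply Continuous.subtype_mk
    exact ((continuous_subtype_val.comp continuous_fst).matrix_mul
      (continuous_subtype_val.comp continuous_snd))
  continuous_inv := by
    apply Continuous.subtype_mk
    exact continuous_star.comp continuous_subtype_val

noncomputable instance : MeasurableSpace (Matrix (Fin 4) (Fin 4) ℂ) :=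
  inferInstanceAs (MeasurableSpace (Fin 4 → Fin 4 → ℂ))

instance : BorelSpace (Matrix (Fin 4) (Fin 4) ℂ) :=
  inferInstanceAs (BorelSpace (Fin 4 → Fin 4 → ℂ))

theorem isClosed :
    IsClosed (Matrix.specialUnitaryGroup (Fin 4) ℂ : Set (Matrix (Fin 4) (Fin 4) ℂ)) := by
  have h1 : IsClosed {M : Matrix (Fin 4) (Fin 4) ℂ | star M * M = 1} :=
    isClosed_eq ((continuous_id.matrix_conjTranspose).matrix_mul continuous_id) continuous_const
  have h2 : IsClosed {M : Matrix (Fin 4) (Fin 4) ℂ | M * star M = 1} :=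
    isClosed_eq (continuous_id.matrix_mul (continuous_id.matrix_conjTranspose)) continuous_const
  have h3 : IsClosed {M : Matrix (Fin 4) (Fin 4) ℂ | M.det = 1} :=
    isClosed_eq continuous_id.matrix_det continuous_const
  have : (Matrix.specialUnitaryGroup (Fin 4) ℂ : Set (Matrix (Fin 4) (Fin 4) ℂ)) =
      ({M | star M * M = 1} ∩ {M | M * star M = 1}) ∩ {M | M.det = 1} := by
    ext M
    simp only [SetLike.mem_coe, Matrix.mem_specialUnitaryGroup_iff, Unitary.mem_iff,
      Set.mem_inter_iff, Set.mem_setOf_eq]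
  rw [this]
  exact ((h1.inter h2)).inter h3

theorem isCompact :
    IsCompact (Matrix.specialUnitaryGroup (Fin 4) ℂ : Set (Matrix (Fin 4) (Fin 4) ℂ)) := by
  have hK : IsCompact (Set.pi Set.univ fun _ : Fin 4 => Set.pi Set.univ fun _ : Fin 4 =>
      Metric.closedBall (0 : ℂ) 1 : Set (Matrix (Fin 4) (Fin 4) ℂ)) :=
    isCompact_univ_pi fun _ => isCompact_univ_pi fun _ => isCompact_closedBall _ _
  refine IsCompact.of_isClosed_subset hK isClosed ?_
  intro M hM
  refine fun i _ => fun j _ => ?_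
  simp only [Metric.mem_closedBall, dist_zero_right]
  exact entry_norm_bound_of_unitary (Matrix.mem_specialUnitaryGroup_iff.mp hM).1 i j

instance : CompactSpace SU4 :=
  isCompact_iff_compactSpace.mp isCompact

noncomputable instance : MeasurableSpace SU4 := borel SU4

instance : BorelSpace SU4 := ⟨rfl⟩

end SU4

/-- The Haar probability measure on `SU(4)`. -/
noncomputable def haarSU4 : Measure SU4 :=
  Measure.haarMeasure ⟨⟨Set.univ, isCompact_univ⟩, by simp⟩

instance : IsProbabilityMeasure haarSU4 := by
  constructor
  have h : Measure.haarMeasure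
      (⟨⟨Set.univ, isCompact_univ⟩, by simp⟩ : TopologicalSpace.PositiveCompacts SU4)
      (⟨⟨Set.univ, isCompact_univ⟩, by simp⟩ : TopologicalSpace.PositiveCompacts SU4) = 1 :=
    Measure.haarMeasure_self
  simpa [haarSU4] using h

/-- The product of Haar probability measures on `SU(4)^{×R}`: the distribution of a random
quantum circuit with `R` gates in a fixed architecture. -/
noncomputable def muSU4 (R : ℕ) : Measure (Fin R → SU4) :=
  Measure.pi fun _ => haarSU4

/-! ## The differential of the contraction map, its rank, and the accessible dimension -/

/-- The Lie algebra `su(m)` of traceless skew-Hermitian matrices, as a real subspace. -/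
noncomputable def suAlgebra (m : Type*) [Fintype m] [DecidableEq m] :
    Submodule ℝ (Matrix m m ℂ) :=
  Submodule.span ℝ {H | Hᴴ = -H ∧ H.trace = 0}

/-- `embedGate` as a real-linear map in the gate entry. -/
noncomputable def embedLin {n : ℕ} (p : Fin n × Fin n) :
    Matrix (Fin 4) (Fin 4) ℂ →ₗ[ℝ] NMatrix n where
  toFun := embedGate p
  map_add' u v := by
    funext a b
    simp only [embedGate, Matrix.add_apply]
    split <;> simp
  map_smul' r u := by
    funext a b
    simp only [embedGate, Matrix.smul_apply, RingHom.id_apply]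
    split <;> simp

/-- The differential of the contraction map `F^A` at the point `x ∈ SU(4)^{×R}`, read in the
exponential charts: the direction `(H_1, …, H_R)` is mapped to
`∑_j (U_R)_{p_R} ⋯ (U_{j+1})_{p_{j+1}} · (H_j)_{p_j} · (U_j)_{p_j} ⋯ (U_1)_{p_1}`. -/
noncomputable def contractDiff {n R : ℕ} (A : Architecture n R) (x : Fin R → SU4) :
    (Fin R → Matrix (Fin 4) (Fin 4) ℂ) →ₗ[ℝ] NMatrix n :=
  ∑ j : Fin R,
    (LinearMap.mulLeft ℝ (((gateList A x).drop (j + 1)).reverse.prod)) ∘ₗ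
      (LinearMap.mulRight ℝ
        (embedGate (A j).1 (x j : Matrix (Fin 4) (Fin 4) ℂ) *
          ((gateList A x).take j).reverse.prod)) ∘ₗ
      (embedLin (A j).1) ∘ₗ
      (LinearMap.proj j)

/-- The rank of (the differential of) the contraction map `F^A` at `x`: the dimension of
the image, under the differential, of the tangent space `su(4)^{×R}`. -/
noncomputable def rankAt {n R : ℕ} (A : Architecture n R) (x : Fin R → SU4) : ℕ :=
  Module.finrank ℝ
    ↥(Submodule.map (contractDiff A x) (Submodule.pi Set.univ fun _ => suAlgebra (Fin 4)))

/-- The maximal rank `r_max` of the contraction map `F^A` over all points of `SU(4)^{×R}`. -/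
noncomputable def rmax {n R : ℕ} (A : Architecture n R) : ℕ := ⨆ x, rankAt A x

/-- A matrix viewed as a point of the Euclidean (Frobenius) space of its entries. -/
noncomputable def toEuc {n : ℕ} (M : NMatrix n) :
    EuclideanSpace ℂ (QubitBasis n × QubitBasis n) :=
  WithLp.toLp 2 fun p => M p.1 p.2

/-- The Frobenius norm `‖X‖_F = (tr (X† X))^{1/2}` of an `n`-qubit matrix. -/
noncomputable def frobNorm {n : ℕ} (M : NMatrix n) : ℝ := ‖toEuc M‖

/-- The accessible dimension `d_A` of an architecture `A`: the Hausdorff dimension of the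
set `U(A)` of unitaries implementable with `A`, with respect to the Frobenius metric. -/
noncomputable def accessibleDim {n R : ℕ} (A : Architecture n R) : ℝ≥0∞ :=
  dimH (toEuc '' Set.range (contract A))

/-! ## Pauli strings and Clifford gates -/

/-- The Pauli matrices `1, X, Y, Z`. -/
noncomputable def pauli : Fin 4 → Matrix (Fin 2) (Fin 2) ℂ
  | 0 => 1
  | 1 => !![0, 1; 1, 0]
  | 2 => !![0, -Complex.I; Complex.I, 0]
  | 3 => !![1, 0; 0, -1]

/-- The `n`-qubit Pauli string `⨂ᵢ pauli (s i)`. -/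
noncomputable def pauliString {n : ℕ} (s : Fin n → Fin 4) : NMatrix n :=
  fun a b => ∏ i, pauli (s i) (a i) (b i)

/-- A two-qubit Pauli string, as a `4 × 4` matrix. -/
noncomputable def pauli2 (s : Fin 2 → Fin 4) : Matrix (Fin 4) (Fin 4) ℂ :=
  fun a b =>
    pauli (s 0) ⟨a.val / 2, by have := a.isLt; omega⟩ ⟨b.val / 2, by have := b.isLt; omega⟩ *
    pauli (s 1) ⟨a.val % 2, by have := a.isLt; omega⟩ ⟨b.val % 2, by have := b.isLt; omega⟩

/-- A two-qubit gate is Clifford if it maps every Pauli string to a scalar multiple of a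
Pauli string under conjugation. -/
def IsCliffordGate (u : Matrix (Fin 4) (Fin 4) ℂ) : Prop :=
  ∀ s : Fin 2 → Fin 4, ∃ (c : ℂ) (s' : Fin 2 → Fin 4),
    u * pauli2 s * uᴴ = c • pauli2 s'

/-- Application to the state `|0^n⟩`, `M ↦ M |0^n⟩`, as a real-linear map. -/
noncomputable def mulVecKet0 (n : ℕ) : NMatrix n →ₗ[ℝ] (QubitBasis n → ℂ) where
  toFun M := M *ᵥ ket0 n
  map_add' M N := Matrix.add_mulVec M N (ket0 n)
  map_smul' r M := by
    simp only [RingHom.id_apply]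
    exact Matrix.smul_mulVec r M (ket0 n)

/-- The rank of (the differential of) the map `G^A : x ↦ F^A(x)|0^n⟩` at `x`. -/
noncomputable def stateRankAt {n R : ℕ} (A : Architecture n R) (x : Fin R → SU4) : ℕ :=
  Module.finrank ℝ
    ↥(Submodule.map ((mulVecKet0 n) ∘ₗ contractDiff A x)
      (Submodule.pi Set.univ fun _ => suAlgebra (Fin 4)))

/-! ## Trace norm and operator norm -/

/-- The positive semidefinite square root of a positive semidefinite matrix
(the definition of the older Mathlib, since removed). -/
noncomputable def Matrix.PosSemidef.sqrt {n 𝕜 : Type*} [Fintype n] [RCLike 𝕜] [DecidableEq n]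
    {A : Matrix n n 𝕜} (hA : A.PosSemidef) : Matrix n n 𝕜 :=
  hA.1.eigenvectorUnitary.1 * Matrix.diagonal ((↑) ∘ Real.sqrt ∘ hA.1.eigenvalues) *
    (star hA.1.eigenvectorUnitary : Matrix n n 𝕜)

/-- The trace norm `‖M‖₁ = tr ((M† M)^{1/2})` of a square complex matrix. -/
noncomputable def traceNorm {m : Type*} [Fintype m] [DecidableEq m] (M : Matrix m m ℂ) : ℝ :=
  ((Matrix.posSemidef_conjTranspose_mul_self M).sqrt.trace).re

/-- The operator norm (largest singular value) of a square complex matrix: the norm of the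
induced operator between Euclidean spaces. -/
noncomputable def opNorm {m : Type*} [Fintype m] [DecidableEq m] (M : Matrix m m ℂ) : ℝ :=
  ‖LinearMap.toContinuousLinearMap (Matrix.toEuclideanLin M)‖

/-! ## The uniform measure on a finite index set -/

/-- The uniform probability measure on `Fin m`. -/
noncomputable def uniformFin (m : ℕ) : Measure (Fin m) :=
  ((m : ℝ≥0∞))⁻¹ • Measure.count

instance (m : ℕ) : IsFiniteMeasure (uniformFin m) := by
  constructor
  rw [uniformFin, Measure.smul_apply, smul_eq_mul, Measure.count_univ,
    ENat.card_eq_coe_fintype_card, Fintype.card_fin, ENat.toENNReal_coe]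
  rcases Nat.eq_zero_or_pos m with h | h
  · simp [h]
  · rw [ENNReal.inv_mul_cancel (by exact_mod_cast h.ne') (by simp)]
    exact ENNReal.one_lt_top

section Aux
open Topology Filter

theorem aux_antilip_near {E F : Type*} [NormedAddCommGroup E] [NormedSpace ℝ E]
    [FiniteDimensional ℝ E] [NormedAddCommGroup F] [NormedSpace ℝ F] {f : E → F} {f' : E →L[ℝ] F}
    {a : E} (hf : HasStrictFDerivAt f f' a) (hinj : Function.Injective f') :
    ∃ s ∈ 𝓝 a, ∃ K : NNReal, AntilipschitzWith K (s.domRestrict f) := by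
  obtain ⟨K, hK0, hK⟩ := (f' : E →ₗ[ℝ] F).exists_antilipschitzWith
    (LinearMap.ker_eq_bot.2 hinj)
  have hc : 0 < K⁻¹ / 2 := by positivity
  obtain ⟨s, hs, hfs⟩ := hf.approximates_deriv_on_nhds (c := K⁻¹ / 2) (Or.inr hc)
  refine ⟨s, hs, (K⁻¹ - K⁻¹ / 2)⁻¹, ?_⟩
  have h2 : K⁻¹ / 2 < K⁻¹ := NNReal.half_lt_self (by positivity)
  have := ((show AntilipschitzWith K f' from hK).domRestrict s).add_lipschitzWith
    hfs.lipschitz_sub h2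
  convert! this using 1
  ext x
  simp [Set.domRestrict]

theorem aux_dimH_le {E F : Type*} [EMetricSpace E] [EMetricSpace F]
    {f : E → F} {s t : Set E} {K : NNReal}
    (h : AntilipschitzWith K (s.domRestrict f)) (hts : t ⊆ s) : dimH t ≤ dimH (f '' t) := by
  have h1 : t = ((↑) : s → E) '' ((↑) ⁻¹' t) := by
    rw [Subtype.image_preimage_coe, Set.inter_eq_right.2 hts]
  have h2 := h.le_dimH_image ((↑) ⁻¹' t : Set s)
  rw [h1, isometry_subtype_coe.dimH_image]
  refine h2.trans (dimH_mono ?_)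
  rintro _ ⟨x, hx, rfl⟩
  exact ⟨x, ⟨x, hx, rfl⟩, rfl⟩

theorem aux_hausdorff_le {E F : Type*} [EMetricSpace E] [EMetricSpace F]
    [MeasurableSpace E] [BorelSpace E] [MeasurableSpace F] [BorelSpace F]
    {f : E → F} {s t : Set E} {K : NNReal} {d : ℝ} (hd : 0 ≤ d)
    (h : AntilipschitzWith K (s.domRestrict f)) (hts : t ⊆ s)
    (h0 : Measure.hausdorffMeasure d (f '' t) = 0) : Measure.hausdorffMeasure d t = 0 := by
  have h1 : t = ((↑) : s → E) '' ((↑) ⁻¹' t) := by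
    rw [Subtype.image_preimage_coe, Set.inter_eq_right.2 hts]
  have h2 := h.le_hausdorffMeasure_image hd ((↑) ⁻¹' t : Set s)
  rw [h1, isometry_subtype_coe.hausdorffMeasure_image (Or.inl hd)]
  refine le_antisymm (h2.trans ?_) zero_le
  have : s.domRestrict f '' ((↑) ⁻¹' t : Set s) ⊆ f '' t := by
    rintro _ ⟨x, hx, rfl⟩
    exact ⟨x, hx, rfl⟩
  rw [measure_mono_null this h0, mul_zero]

theorem aux_zero_null {κ : Type*} [Fintype κ] {g : (κ → ℝ) → ℝ}
    (hg : AnalyticOnNhd ℝ g Set.univ) {t0 : κ → ℝ} (h0 : g t0 ≠ 0) :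
    volume {t | g t = 0} = 0 := by
  have hcont : Continuous g := continuousOn_univ.1 hg.continuousOn
  let Z : Set (ℝ × (κ → ℝ)) := {p | g (t0 + p.1 • p.2) = 0}
  have hZ : MeasurableSet Z := by
    apply IsClosed.measurableSet
    exact isClosed_eq (by fun_prop) continuous_const
  have hline : ∀ t : κ → ℝ, volume {s : ℝ | g (t0 + s • t) = 0} = 0 := by
    intro t
    have han : AnalyticOnNhd ℝ (fun s : ℝ => g (t0 + s • t)) Set.univ := by
      intro s _
      refine AnalyticAt.comp (g := g) (hg _ trivial) ?_
      fun_prop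
    refine measure_null_of_locally_null _ fun s _ => ?_
    rcases (han s trivial).eventually_eq_zero_or_eventually_ne_zero with h | h
    · exfalso
      have := han.eqOn_zero_of_preconnected_of_eventuallyEq_zero isPreconnected_univ
        (Set.mem_univ s) h
      have := this (Set.mem_univ 0)
      simp at this
      exact h0 this
    · refine ⟨insert s {s | g (t0 + s • t) = 0}ᶜ ∩ {s | g (t0 + s • t) = 0}, ?_, ?_⟩
      · rw [Set.inter_comm]
        refine inter_mem_nhdsWithin _ ?_
        rw [← nhdsNE_sup_pure]
        refine ⟨?_, ?_⟩
        · filter_upwards [h] with x hx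
          exact Or.inr hx
        · simp
      · refine measure_mono_null (t := {s}) ?_ (by simp)
        rintro x ⟨rfl | hx, hx2⟩
        · rfl
        · exact absurd hx2 hx
  have hnull : (volume : Measure (ℝ × (κ → ℝ))) Z = 0 := by
    rw [Measure.volume_eq_prod]
    rw [← Measure.prod_swap, Measure.map_apply measurable_swap hZ]
    rw [Measure.measure_prod_null (measurable_swap hZ)]
    exact Filter.Eventually.of_forall hline
  rw [Measure.volume_eq_prod, Measure.measure_prod_null hZ] at hnull
  have hne : ∀ᵐ s : ℝ, s ≠ 0 := by
    simp [ae_iff]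
  obtain ⟨s, hs1, hs2⟩ := (hnull.and hne).exists
  have hs1' : volume {t : κ → ℝ | g (t0 + s • t) = 0} = 0 := hs1
  have heq : {t : κ → ℝ | g (t0 + s • t) = 0} = (fun t => s • t) ⁻¹' ((fun t => t0 + t) ⁻¹' {t | g t = 0}) := rfl
  rw [heq, Measure.addHaar_preimage_smul _ hs2, measure_preimage_add] at hs1'
  rcases mul_eq_zero.1 hs1' with h | h
  · exfalso
    simp at h
    exact absurd h (not_le.2 (by positivity))
  · exact h

open Polynomial in
theorem aux_minpoly {B A : Type*} [CommRing B] [CommRing A] [IsDomain A] [CharZero A] [Algebra B A]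
    (hinj : Function.Injective (algebraMap B A)) {x : A} (hx : IsAlgebraic B x) :
    ∃ p : B[X], aeval x p = 0 ∧ aeval x (derivative p) ≠ 0 := by
  obtain ⟨p, hp0, hp⟩ := hx
  induction hn : p.natDegree using Nat.strong_induction_on generalizing p with
  | _ n ih =>
    by_cases h : aeval x (derivative p) = 0
    · have hdeg : p.natDegree ≠ 0 := by
        intro h0
        rw [natDegree_eq_zero] at h0
        obtain ⟨c, rfl⟩ := h0
        simp at hp
        apply hp0
        rw [(map_eq_zero_iff _ hinj).1 hp]; simp
      have hB : CharZero B := by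
        refine ⟨fun a b hab => ?_⟩
        have := congrArg (algebraMap B A) hab
        simpa using this
      have hBd : IsDomain B := hinj.isDomain (algebraMap B A)
      refine ih _ ?_ (derivative p) ?_ h rfl
      · rw [← hn]; exact natDegree_derivative_lt hdeg
      · intro h1
        exact hdeg (derivative_eq_zero.1 h1)
    · exact ⟨p, hp, h⟩

open Polynomial in
theorem aux_der_eval {A : Type*} [CommRing A] [Algebra ℝ A]
    (d : Derivation ℝ A A) (S : Subalgebra ℝ A) (hS : ∀ a ∈ S, d a = 0) (x : A) (p : S[X]) :
    d (aeval x p) = aeval x (derivative p) * d x := by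
  induction p using Polynomial.induction_on' with
  | add p q hp hq => simp only [map_add, hp, hq]; ring
  | monomial n a =>
    have : d (algebraMap S A a) = 0 := hS _ a.2
    simp only [aeval_monomial, Derivation.leibniz, Derivation.leibniz_pow, this,
      derivative_monomial, map_mul, map_natCast]
    simp
    ring

theorem aux_der_adjoin {A : Type*} [CommRing A] [Algebra ℝ A]
    (d : Derivation ℝ A A) (s : Set A) (hs : ∀ a ∈ s, d a = 0) :
    ∀ a ∈ Algebra.adjoin ℝ s, d a = 0 := by
  intro a ha
  induction ha using Algebra.adjoin_induction with
  | mem x hx => exact hs x hx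
  | algebraMap r => simp
  | add x y _ _ hx hy => simp [hx, hy]
  | mul x y _ _ hx hy => simp [hx, hy]

end Aux

section Aux2
open Topology Filter MvPolynomial

theorem aux_mv_deriv {ι : Type*} [Fintype ι] (p : MvPolynomial ι ℝ) (x : ι → ℝ) :
    HasStrictFDerivAt (fun y : ι → ℝ => eval y p)
      (∑ l, eval x (pderiv l p) • ContinuousLinearMap.proj (R := ℝ) (φ := fun _ : ι => ℝ) l) x := by
  induction p using MvPolynomial.induction_on with
  | C a => simpa using hasStrictFDerivAt_const (𝕜 := ℝ) a x
  | add p q hp hq =>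
    simp only [map_add, add_smul, Finset.sum_add_distrib]
    exact hp.add hq
  | mul_X p i hp =>
    have h1 : HasStrictFDerivAt (fun y : ι → ℝ => y i)
      (ContinuousLinearMap.proj (R := ℝ) (φ := fun _ : ι => ℝ) i) x :=
      (ContinuousLinearMap.proj (R := ℝ) (φ := fun _ : ι => ℝ) i).hasStrictFDerivAt
    have h2 := hp.mul h1
    simp only [map_mul, eval_X]
    convert! h2 using 1
    ext v
    simp only [Derivation.leibniz, pderiv_X, smul_eq_mul, map_add, map_mul, eval_X, add_smul,
      Finset.sum_add_distrib]
    simp [Pi.single_apply, Finset.mul_sum, apply_ite]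
    refine Finset.sum_congr rfl fun l _ => by ring

theorem aux_upper_generic {ι : Type*} [Fintype ι] (P : Ideal (MvPolynomial ι ℝ))
    [P.IsPrime] : ∃ J : Set ι,
      AlgebraicIndepOn ℝ (fun i => Ideal.Quotient.mk P (X i)) J ∧
      ∃ D : MvPolynomial ι ℝ, D ∉ P ∧
        dimH {y : ι → ℝ | (∀ p ∈ P, eval y p = 0) ∧ eval y D ≠ 0} ≤ (J.ncard : ℝ≥0∞) := by
  set y : ι → MvPolynomial ι ℝ ⧸ P := fun i => Ideal.Quotient.mk P (X i) with hy
  have hfin : {J : Set ι | AlgebraicIndepOn ℝ y J}.Finite := Set.toFinite _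
  have hne : {J : Set ι | AlgebraicIndepOn ℝ y J}.Nonempty := by
    refine ⟨∅, ?_⟩
    exact (algebraicIndependent_empty_type_iff (R := ℝ)).2 (algebraMap ℝ _).injective
  obtain ⟨J, hJ⟩ := hfin.exists_maximal hne
  have hJ1 : AlgebraicIndepOn ℝ y J := hJ.prop
  refine ⟨J, hJ1, ?_⟩
  have halg : ∀ i, IsAlgebraic (Algebra.adjoin ℝ (y '' J)) (y i) := by
    intro i
    by_cases hi : i ∈ J
    · exact isAlgebraic_algebraMap
        (⟨y i, Algebra.subset_adjoin ⟨i, hi, rfl⟩⟩ : Algebra.adjoin ℝ (y '' J))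
    · by_contra hc
      have h1 : AlgebraicIndepOn ℝ y (insert i J) :=
        (AlgebraicIndepOn.insert_iff hi).2 ⟨hJ1, hc⟩
      exact hi (hJ.le_of_ge h1 (Set.subset_insert _ _) (Set.mem_insert _ _))
  have hchar : CharZero (MvPolynomial ι ℝ ⧸ P) :=
    charZero_of_injective_algebraMap (algebraMap ℝ _).injective
  have hlift : ∀ i, ∃ p : Polynomial (Algebra.adjoin ℝ ((X : ι → MvPolynomial ι ℝ) '' J)),
      Polynomial.aeval (X i : MvPolynomial ι ℝ) p ∈ P ∧
      Polynomial.aeval (X i : MvPolynomial ι ℝ) (Polynomial.derivative p) ∉ P := by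
    intro i
    obtain ⟨p, hp1, hp2⟩ := aux_minpoly (B := Algebra.adjoin ℝ (y '' J))
      Subtype.val_injective (halg i)
    have hmap : (Algebra.adjoin ℝ ((X : ι → MvPolynomial ι ℝ) '' J)).map
        (Ideal.Quotient.mkₐ ℝ P) = Algebra.adjoin ℝ (y '' J) := by
      rw [AlgHom.map_adjoin, ← Set.image_comp]
      rfl
    let φ : Algebra.adjoin ℝ ((X : ι → MvPolynomial ι ℝ) '' J) →ₐ[ℝ] Algebra.adjoin ℝ (y '' J) :=
      AlgHom.codRestrict ((Ideal.Quotient.mkₐ ℝ P).comp (Subalgebra.val _)) _ (by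
        intro a
        rw [← hmap]
        exact ⟨a, a.2, rfl⟩)
    have hφ : Function.Surjective φ.toRingHom := by
      rintro ⟨b, hb⟩
      rw [← hmap] at hb
      obtain ⟨a, ha, hab⟩ := hb
      exact ⟨⟨a, ha⟩, Subtype.ext hab⟩
    obtain ⟨p', rfl⟩ := Polynomial.map_surjective _ hφ p
    have key : ∀ q : Polynomial (Algebra.adjoin ℝ ((X : ι → MvPolynomial ι ℝ) '' J)),
        Ideal.Quotient.mk P (Polynomial.aeval (X i : MvPolynomial ι ℝ) q) =
        Polynomial.aeval (y i) (q.map φ.toRingHom) := by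
      intro q
      rw [Polynomial.aeval_def, Polynomial.hom_eval₂, Polynomial.aeval_def, Polynomial.eval₂_map]
      rfl
    refine ⟨p', ?_, ?_⟩
    · rw [← Ideal.Quotient.eq_zero_iff_mem, key, hp1]
    · rw [← Ideal.Quotient.eq_zero_iff_mem, key, ← Polynomial.derivative_map]
      exact hp2
  choose p hp1 hp2 using hlift
  refine ⟨∏ i, Polynomial.aeval (X i : MvPolynomial ι ℝ) (Polynomial.derivative (p i)), ?_, ?_⟩
  · intro h
    obtain ⟨i, _, hi⟩ := (Ideal.IsPrime.prod_mem_iff (p := P)).1 h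
    exact hp2 i hi
  by_contra hlt
  push Not at hlt
  obtain ⟨x, ⟨hxP, hxD⟩, hx⟩ := exists_mem_nhdsWithin_lt_dimH_of_lt_dimH hlt
  rw [map_prod, Finset.prod_ne_zero_iff] at hxD
  let Ψ : (ι → ℝ) → (J → ℝ) × (ι → ℝ) := fun z =>
    (fun j => z j, fun i => eval z (Polynomial.aeval (X i : MvPolynomial ι ℝ) (p i)))
  have hΨ : HasStrictFDerivAt Ψ
      ((ContinuousLinearMap.pi fun j : J =>
        ContinuousLinearMap.proj (R := ℝ) (φ := fun _ : ι => ℝ) (j : ι)).prod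
      (ContinuousLinearMap.pi fun i =>
        ∑ l, eval x (pderiv l (Polynomial.aeval (X i : MvPolynomial ι ℝ) (p i))) •
          ContinuousLinearMap.proj (R := ℝ) (φ := fun _ : ι => ℝ) l)) x := by
    refine HasStrictFDerivAt.prodMk ?_ ?_
    · exact ContinuousLinearMap.hasStrictFDerivAt (ContinuousLinearMap.pi fun j : J =>
        ContinuousLinearMap.proj (R := ℝ) (φ := fun _ : ι => ℝ) (j : ι))
    · exact hasStrictFDerivAt_pi'.2 fun i => aux_mv_deriv _ x
  obtain ⟨s, hs, K, hK⟩ := aux_antilip_near hΨ (by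
    rw [injective_iff_map_eq_zero]
    intro v hv
    have hv1 : ∀ j : J, v j = 0 := fun j => congrFun (congrArg Prod.fst hv) j
    have hv2 : ∀ i, ∑ l, eval x (pderiv l (Polynomial.aeval (X i : MvPolynomial ι ℝ) (p i))) * v l
        = 0 := fun i => by
      have := congrFun (congrArg Prod.snd hv) i
      simpa using this
    funext i
    by_cases hi : i ∈ J
    · exact hv1 ⟨i, hi⟩
    have h3 := hv2 i
    rw [Finset.sum_eq_single i] at h3
    · rw [aux_der_eval (pderiv i) _ (aux_der_adjoin _ _ (by
        rintro _ ⟨l, hl, rfl⟩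
        exact pderiv_X_of_ne (fun h => hi (h ▸ hl))))] at h3
      simp only [pderiv_X_self, mul_one] at h3
      exact (mul_eq_zero.1 h3).resolve_left (hxD i (Finset.mem_univ _))
    · intro l _ hl
      by_cases hlJ : l ∈ J
      · rw [hv1 ⟨l, hlJ⟩, mul_zero]
      · rw [aux_der_eval (pderiv l) _ (aux_der_adjoin _ _ (by
          rintro _ ⟨m, hm, rfl⟩
          exact pderiv_X_of_ne (fun h => hlJ (h ▸ hm))))]
        rw [pderiv_X_of_ne (Ne.symm hl)]
        simp
    · simp)
  refine absurd (hx _ (inter_mem_nhdsWithin _ hs)) (not_lt.2 ?_)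
  refine (aux_dimH_le hK Set.inter_subset_right).trans ?_
  have hsub : Ψ '' ({y : ι → ℝ | (∀ p ∈ P, eval y p = 0) ∧ eval y (∏ i, Polynomial.aeval
      (X i : MvPolynomial ι ℝ) (Polynomial.derivative (p i))) ≠ 0} ∩ s) ⊆
      (fun w : J → ℝ => (w, (0 : ι → ℝ))) '' Set.univ := by
    rintro _ ⟨z, ⟨⟨hz, _⟩, _⟩, rfl⟩
    refine ⟨fun j => z j, trivial, ?_⟩
    refine Prod.ext rfl ?_
    funext i
    exact (hz _ (hp1 i)).symm
  refine (dimH_mono hsub).trans ?_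
  have hlip : LipschitzWith 1 (fun w : J → ℝ => (w, (0 : ι → ℝ))) := LipschitzWith.prodMk_right 0
  refine (hlip.dimH_image_le _).trans ?_
  rw [Real.dimH_univ_pi, ← Nat.card_eq_fintype_card, Nat.card_coe_set_eq]

theorem aux_upper {ι : Type*} [Fintype ι] (r : ℕ) (P : Ideal (MvPolynomial ι ℝ)) :
    P.IsPrime → (∀ J : Set ι,
      AlgebraicIndepOn ℝ (fun i => Ideal.Quotient.mk P (X i)) J → J.ncard ≤ r) →
    dimH {y : ι → ℝ | ∀ p ∈ P, eval y p = 0} ≤ r := by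
  induction P using WellFoundedGT.induction with
  | ind P ih =>
    intro hP hr
    obtain ⟨J, hJ, D, hD, hdim⟩ := aux_upper_generic P
    have hcov : {y : ι → ℝ | ∀ p ∈ P, eval y p = 0} ⊆
        {y : ι → ℝ | (∀ p ∈ P, eval y p = 0) ∧ eval y D ≠ 0} ∪
        ⋃ Q ∈ Ideal.minimalPrimes (P ⊔ Ideal.span {D}), {y : ι → ℝ | ∀ p ∈ Q, eval y p = 0} := by
      intro z hz
      by_cases h : eval z D = 0
      · right
        have hprime : (RingHom.ker (eval z)).IsPrime := RingHom.ker_isPrime _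
        have hle : P ⊔ Ideal.span {D} ≤ RingHom.ker (eval z) := by
          refine sup_le (fun p hp => hz p hp) ?_
          rw [Ideal.span_le, Set.singleton_subset_iff]
          exact h
        obtain ⟨Q, hQ, hQle⟩ := Ideal.exists_minimalPrimes_le hle
        exact Set.mem_biUnion hQ fun p hp => hQle hp
      · exact Or.inl ⟨hz, h⟩
    refine (dimH_mono hcov).trans ?_
    rw [dimH_union]
    refine max_le (hdim.trans (by exact_mod_cast hr J hJ)) ?_
    rw [dimH_bUnion (Ideal.finite_minimalPrimes_of_isNoetherianRing _ _).countable]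
    refine iSup₂_le fun Q hQ => ?_
    have hQ1 : P ⊔ Ideal.span {D} ≤ Q := hQ.1.2
    have hPQ : P ≤ Q := le_sup_left.trans hQ1
    have hDQ : D ∈ Q := hQ1 (Ideal.mem_sup_right (Ideal.mem_span_singleton_self D))
    refine ih Q (lt_of_le_of_ne hPQ (fun h => hD (h ▸ hDQ))) hQ.1.1 fun J' hJ' => hr J' ?_
    exact AlgebraicIndependent.of_comp (Ideal.Quotient.factorₐ ℝ hPQ) hJ'

end Aux2

section Aux3
open Topology Filter MvPolynomial

/-- The ring of real analytic functions on `κ → ℝ`. -/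
def AnRing (κ : Type) [Fintype κ] : Subalgebra ℝ ((κ → ℝ) → ℝ) where
  carrier := {g | AnalyticOnNhd ℝ g Set.univ}
  mul_mem' ha hb := ha.mul hb
  add_mem' ha hb := ha.add hb
  algebraMap_mem' r := (analyticOnNhd_const : AnalyticOnNhd ℝ (fun _ : κ → ℝ => r) Set.univ)

theorem AnRing.an {κ : Type} [Fintype κ] (g : AnRing κ) : AnalyticOnNhd ℝ g.1 Set.univ := g.2

theorem AnRing.diff {κ : Type} [Fintype κ] (g : AnRing κ) (t : κ → ℝ) :
    DifferentiableAt ℝ g.1 t := (AnRing.an g t trivial).differentiableAt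

instance AnRing.noZeroDiv {κ : Type} [Fintype κ] : NoZeroDivisors (AnRing κ) where
  eq_zero_or_eq_zero_of_mul_eq_zero := by
    intro a b hab
    by_contra hc
    push Not at hc
    obtain ⟨ha, hb⟩ := hc
    have : ∃ t, a.1 t ≠ 0 := by
      by_contra h
      push Not at h
      exact ha (Subtype.ext (funext h))
    obtain ⟨t, ht⟩ := this
    have hev : ∀ᶠ z in 𝓝 t, a.1 z ≠ 0 := (AnRing.diff a t).continuousAt.eventually_ne ht
    have hz : b.1 =ᶠ[𝓝 t] 0 := by
      filter_upwards [hev] with z hz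
      have : a.1 z * b.1 z = 0 := congrFun (congrArg Subtype.val hab) z
      exact (mul_eq_zero.1 this).resolve_left hz
    have := (AnRing.an b).eqOn_zero_of_preconnected_of_eventuallyEq_zero isPreconnected_univ
      (Set.mem_univ t) hz
    exact hb (Subtype.ext (funext fun z => this (Set.mem_univ z)))

instance AnRing.nontriv {κ : Type} [Fintype κ] : Nontrivial (AnRing κ) :=
  ⟨⟨0, 1, fun h => zero_ne_one (congrFun (congrArg Subtype.val h) (0 : κ → ℝ))⟩⟩

instance AnRing.dom {κ : Type} [Fintype κ] : IsDomain (AnRing κ) := NoZeroDivisors.to_isDomain _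

instance AnRing.faith {κ : Type} [Fintype κ] : FaithfulSMul ℝ (AnRing κ) :=
  (faithfulSMul_iff_algebraMap_injective ℝ _).2 (algebraMap ℝ (AnRing κ)).injective

/-- Partial derivative of analytic functions, as a derivation. -/
noncomputable def AnRing.D {κ : Type} [Fintype κ] (i : κ) :
    Derivation ℝ (AnRing κ) (AnRing κ) where
  toFun g := ⟨fun t => fderiv ℝ g.1 t (Pi.single i 1), by
    intro t _
    exact ((ContinuousLinearMap.apply ℝ ℝ (Pi.single i 1 : κ → ℝ)).analyticAt _).comp
      ((AnRing.an g).fderiv t trivial)⟩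
  map_add' a b := by
    apply Subtype.ext
    funext t
    change fderiv ℝ (a.1 + b.1) t _ = _
    rw [fderiv_add (AnRing.diff a t) (AnRing.diff b t)]
    rfl
  map_smul' c a := by
    apply Subtype.ext
    funext t
    change fderiv ℝ (c • a.1) t _ = _
    rw [fderiv_const_smul (AnRing.diff a t)]
    rfl
  map_one_eq_zero' := by
    apply Subtype.ext
    funext t
    change fderiv ℝ (fun _ : κ → ℝ => (1 : ℝ)) t _ = _
    simp
  leibniz' a b := by
    apply Subtype.ext
    funext t
    change fderiv ℝ (a.1 * b.1) t _ = _
    rw [fderiv_mul (AnRing.diff a t) (AnRing.diff b t)]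
    rfl

/-- Coordinate functions. -/
def AnRing.x {κ : Type} [Fintype κ] (i : κ) : AnRing κ :=
  ⟨fun t => t i, fun t _ => (ContinuousLinearMap.proj (R := ℝ) (φ := fun _ : κ => ℝ) i).analyticAt t⟩

theorem AnRing.D_x {κ : Type} [Fintype κ] (i j : κ) :
    AnRing.D i (AnRing.x j) = if i = j then 1 else 0 := by
  apply Subtype.ext
  funext t
  change fderiv ℝ (ContinuousLinearMap.proj (R := ℝ) (φ := fun _ : κ => ℝ) j) t _ = _
  rw [ContinuousLinearMap.fderiv]
  by_cases h : i = j
  · subst h; simp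
  · simp [h, Ne.symm h]

theorem AnRing.fderiv_eq {κ : Type} [Fintype κ] (g : AnRing κ) (t v : κ → ℝ) :
    fderiv ℝ g.1 t v = ∑ i, (AnRing.D i g).1 t * v i := by
  conv_lhs => rw [pi_eq_sum_univ' v]
  rw [map_sum]
  refine Finset.sum_congr rfl fun i _ => ?_
  rw [map_smul, smul_eq_mul, mul_comm]
  congr 2

/-- Evaluation at a point. -/
def AnRing.ev {κ : Type} [Fintype κ] (t : κ → ℝ) : AnRing κ →ₐ[ℝ] ℝ :=
  (Pi.evalAlgHom ℝ (fun _ : κ → ℝ => ℝ) t).comp (AnRing κ).val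

theorem AnRing.aeval_apply {κ ι : Type} [Fintype κ] (f : ι → AnRing κ) (p : MvPolynomial ι ℝ)
    (t : κ → ℝ) : (aeval f p).1 t = eval (fun j => (f j).1 t) p := by
  have h : (AnRing.ev t).comp (aeval f) = aeval (fun j => (f j).1 t) := by
    ext j
    simp [AnRing.ev]
  exact DFunLike.congr_fun h p

theorem AnRing.x_indep {κ : Type} [Fintype κ] :
    AlgebraicIndependent ℝ (AnRing.x : κ → AnRing κ) := by
  rw [algebraicIndependent_iff]
  intro p hp
  apply MvPolynomial.funext
  intro t
  have := AnRing.aeval_apply (AnRing.x : κ → AnRing κ) p t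
  rw [hp] at this
  simpa [AnRing.x] using this.symm

theorem AnRing.det_ne {κ : Type} [Fintype κ] (I : Set (AnRing κ))
    (hI : ∀ i, IsAlgebraic (Algebra.adjoin ℝ I) (AnRing.x i : AnRing κ))
    (e : κ ≃ I) : Matrix.det (Matrix.of fun a i : κ => AnRing.D i (e a).1) ≠ 0 := by
  intro hdet
  obtain ⟨v, hv0, hv⟩ := Matrix.exists_mulVec_eq_zero_iff.2 hdet
  apply hv0
  let d : Derivation ℝ (AnRing κ) (AnRing κ) := ∑ i, v i • AnRing.D i
  have hd : ∀ g, d g = ∑ i, v i * AnRing.D i g := by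
    intro g
    have h := map_sum (Derivation.coeFnAddMonoidHom (R := ℝ) (A := AnRing κ) (M := AnRing κ))
      (fun i => v i • AnRing.D i) Finset.univ
    have h2 := congrFun h g
    rw [Finset.sum_apply] at h2
    exact h2
  have hdI : ∀ g ∈ I, d g = 0 := by
    intro g hg
    have := congrFun hv (e.symm ⟨g, hg⟩)
    rw [hd]
    simp [Matrix.mulVec, dotProduct] at this
    rw [← this]
    exact Finset.sum_congr rfl fun i _ => mul_comm _ _
  funext i
  obtain ⟨p, hp1, hp2⟩ := aux_minpoly (B := Algebra.adjoin ℝ I) Subtype.val_injective (hI i)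
  have h1 := aux_der_eval d _ (aux_der_adjoin d I hdI) (AnRing.x i) p
  rw [hp1, map_zero] at h1
  have h2 := (mul_eq_zero.1 h1.symm).resolve_left hp2
  rw [hd] at h2
  simpa [AnRing.D_x] using h2

theorem AnRing.main {κ ι : Type} [Fintype κ] [Fintype ι] (f : ι → AnRing κ)
    (hf : ∀ j, IsAlgebraic (Algebra.adjoin ℝ (Set.range (AnRing.x : κ → AnRing κ))) (f j))
    (S : Set (ι → ℝ))
    (hS : dimH S < dimH (closure (Set.range fun (t : κ → ℝ) j => (f j).1 t))) :
    volume {t : κ → ℝ | (fun j => (f j).1 t) ∈ S} = 0 := by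
  let M := AlgebraicIndependent.matroid ℝ (AnRing κ)
  obtain ⟨s0, hs0⟩ := M.exists_isBasis (Set.range f)
  have hs0f : s0.Finite := (Set.finite_range f).subset hs0.subset
  -- upper bound
  have hup : dimH (closure (Set.range fun (t : κ → ℝ) j => (f j).1 t)) ≤ s0.ncard := by
    have hsub : closure (Set.range fun (t : κ → ℝ) j => (f j).1 t) ⊆
        {y : ι → ℝ | ∀ p ∈ RingHom.ker (aeval f : MvPolynomial ι ℝ →ₐ[ℝ] AnRing κ), eval y p = 0} := by
      apply closure_minimal
      · rintro _ ⟨t, rfl⟩ p hp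
        rw [← AnRing.aeval_apply, (RingHom.mem_ker).1 hp]
        rfl
      · simp only [Set.ofPred_forall]
        refine isClosed_iInter fun p => isClosed_iInter fun _ => ?_
        exact isClosed_eq (MvPolynomial.continuous_eval p) continuous_const
    refine (dimH_mono hsub).trans ?_
    refine aux_upper _ _ (RingHom.ker_isPrime _) fun J hJ => ?_
    have h1 : AlgebraicIndepOn ℝ f J := by
      have := AlgebraicIndependent.map' hJ (f := Ideal.kerLiftAlg (aeval f : MvPolynomial ι ℝ →ₐ[ℝ] AnRing κ))
        (Ideal.kerLiftAlg_injective _)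
      convert! this using 1
      funext j
      simp [Function.comp]
    have h2 : M.Indep (f '' J) := by
      have := h1.coe_range
      rw [AlgebraicIndependent.matroid_indep_iff]
      have hr : Set.range (fun i : J => f i) = f '' J := by
        ext; simp
      rw [hr] at this
      exact this
    obtain ⟨I', hI', hsubI⟩ := h2.subset_isBasis_of_subset (X := Set.range f) (by simp)
    have hcard := hI'.encard_eq_encard hs0
    have hinj : Set.InjOn f J := Set.injOn_iff_injective.2 h1.injective
    rw [← hinj.ncard_image]
    have h3 : (f '' J).encard ≤ s0.encard := hcard ▸ Set.encard_le_encard hsubI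
    rw [Set.ncard, Set.ncard]
    exact ENat.toNat_le_toNat h3 hs0f.encard_lt_top.ne
  -- extend to a basis
  have hbx : M.IsBasis (Set.range AnRing.x) (s0 ∪ Set.range AnRing.x) := by
    rw [AlgebraicIndependent.matroid_isBasis_iff]
    refine ⟨AnRing.x_indep.coe_range, Set.subset_union_right, ?_⟩
    rintro a (ha | ⟨i, rfl⟩)
    · obtain ⟨j, rfl⟩ := hs0.subset ha
      exact hf j
    · exact isAlgebraic_algebraMap
        (⟨AnRing.x i, Algebra.subset_adjoin ⟨i, rfl⟩⟩ : Algebra.adjoin ℝ (Set.range AnRing.x))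
  obtain ⟨I, hI, hs0I⟩ := hs0.indep.subset_isBasis_of_subset
    (X := s0 ∪ Set.range AnRing.x) Set.subset_union_left
  have hIcard : I.encard = Fintype.card κ := by
    rw [hI.encard_eq_encard hbx, ← Set.image_univ, (AnRing.x_indep.injective).encard_image]
    simp
  have hIfin : I.Finite := Set.finite_of_encard_eq_coe hIcard
  have : Fintype I := hIfin.fintype
  have hIc : Fintype.card I = Fintype.card κ := by
    rw [← Nat.card_eq_fintype_card (α := I), Nat.card_coe_set_eq, Set.ncard, hIcard]
    simp
  let e : κ ≃ I := (Fintype.equivOfCardEq hIc).symm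
  have hdet := AnRing.det_ne I (fun i =>
    (AlgebraicIndependent.matroid_isBasis_iff.1 hI).2.2 _ (Or.inr ⟨i, rfl⟩)) e
  set Δ := Matrix.det (Matrix.of fun a i : κ => AnRing.D i (e a).1) with hΔ
  have hΔ0 : ∃ t, Δ.1 t ≠ 0 := by
    by_contra h
    push Not at h
    exact hdet (Subtype.ext (funext h))
  obtain ⟨t0, ht0⟩ := hΔ0
  have hz := aux_zero_null (AnRing.an Δ) ht0
  -- projection to `s0`
  have hσ : ∀ g : {g : I // g.1 ∈ s0}, ∃ j, f j = g.1.1 := fun g => hs0.subset g.2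
  choose σ hσ using hσ
  let pr : (ι → ℝ) → ({g : I // g.1 ∈ s0} → ℝ) := fun y g => y (σ g)
  have hpr : LipschitzWith 1 pr := by
    refine LipschitzWith.of_edist_le fun a b => ?_
    simp only [pr]
    rw [edist_pi_le_iff]
    intro g
    exact edist_le_pi_edist a b (σ g)
  have hcard0 : Fintype.card {g : I // g.1 ∈ s0} = s0.ncard := by
    rw [← Nat.card_eq_fintype_card, ← Nat.card_coe_set_eq]
    refine Nat.card_congr
      ⟨fun g => ⟨g.1.1, g.2⟩, fun g => ⟨⟨g.1, hs0I g.2⟩, g.2⟩, fun _ => rfl, fun _ => rfl⟩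
  have hB : volume (pr '' S) = 0 := by
    rw [← hausdorffMeasure_pi_real, hcard0]
    have h1 : dimH (pr '' S) < ((s0.ncard : NNReal) : ℝ≥0∞) := by
      refine ((hpr.dimH_image_le S).trans_lt hS).trans_le ?_
      simpa using hup
    have := hausdorffMeasure_of_dimH_lt h1
    simpa using this
  have hN : volume {w : I → ℝ | (fun g : {g : I // g.1 ∈ s0} => w g.1) ∈ pr '' S} = 0 := by
    have h1 := volume_preserving_piEquivPiSubtypeProd (fun _ : I => ℝ) (fun g : I => g.1 ∈ s0)
    have h2 := Measure.quasiMeasurePreserving_fst.comp h1.quasiMeasurePreserving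
    exact h2.preimage_null hB
  let G : (κ → ℝ) → (I → ℝ) := fun t g => g.1.1 t
  have hG : ∀ t, HasStrictFDerivAt G (ContinuousLinearMap.pi fun g : I => fderiv ℝ g.1.1 t) t := by
    intro t
    refine hasStrictFDerivAt_pi'.2 fun g => ?_
    exact (AnRing.an g.1 t trivial).hasStrictFDerivAt
  have hT : volume ({t : κ → ℝ | (fun j => (f j).1 t) ∈ S} ∩ {t | Δ.1 t ≠ 0}) = 0 := by
    refine measure_null_of_locally_null _ fun t ht => ?_
    obtain ⟨s, hs, K, hK⟩ := aux_antilip_near (hG t) (by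
      rw [injective_iff_map_eq_zero]
      intro v hv
      let m : Matrix κ κ ℝ := (AnRing.ev t).mapMatrix (Matrix.of fun a i : κ => AnRing.D i (e a).1)
      have hm : m.det ≠ 0 := by
        rw [← AlgHom.map_det]
        exact ht.2
      refine Matrix.eq_zero_of_mulVec_eq_zero hm ?_
      funext a
      have h1 : fderiv ℝ (e a).1.1 t v = 0 := congrFun hv (e a)
      rw [AnRing.fderiv_eq] at h1
      exact h1)
    refine ⟨_, inter_mem_nhdsWithin _ hs, ?_⟩
    rw [← hausdorffMeasure_pi_real]
    refine aux_hausdorff_le (Nat.cast_nonneg _) hK Set.inter_subset_right ?_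
    rw [← hIc, hausdorffMeasure_pi_real]
    refine measure_mono_null ?_ hN
    rintro _ ⟨z, ⟨⟨hz, _⟩, _⟩, rfl⟩
    refine ⟨_, hz, ?_⟩
    funext g
    simp only [pr, G]
    rw [hσ]
  refine measure_mono_null (t := ({t : κ → ℝ | (fun j => (f j).1 t) ∈ S} ∩ {t | Δ.1 t ≠ 0}) ∪
    {t | Δ.1 t = 0}) ?_ (measure_union_null hT hz)
  intro t ht
  by_cases h : Δ.1 t = 0
  · exact Or.inr h
  · exact Or.inl ⟨ht, h⟩

end Aux3

section Aux4

/-- Regular functions: analytic and algebraic over the coordinates. -/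
def IsReg {κ : Type} [Fintype κ] (g : (κ → ℝ) → ℝ) : Prop :=
  ∃ a : AnRing κ, a.1 = g ∧
    IsAlgebraic (Algebra.adjoin ℝ (Set.range (AnRing.x : κ → AnRing κ))) a

theorem IsReg.add {κ : Type} [Fintype κ] {f g : (κ → ℝ) → ℝ} (hf : IsReg f) (hg : IsReg g) :
    IsReg (fun t => f t + g t) := by
  obtain ⟨a, rfl, ha⟩ := hf
  obtain ⟨b, rfl, hb⟩ := hg
  exact ⟨a + b, rfl, ha.add hb⟩

theorem IsReg.mul {κ : Type} [Fintype κ] {f g : (κ → ℝ) → ℝ} (hf : IsReg f) (hg : IsReg g) :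
    IsReg (fun t => f t * g t) := by
  obtain ⟨a, rfl, ha⟩ := hf
  obtain ⟨b, rfl, hb⟩ := hg
  exact ⟨a * b, rfl, ha.mul hb⟩

theorem IsReg.neg {κ : Type} [Fintype κ] {f : (κ → ℝ) → ℝ} (hf : IsReg f) :
    IsReg (fun t => - f t) := by
  obtain ⟨a, rfl, ha⟩ := hf
  exact ⟨-a, rfl, ha.neg⟩

theorem IsReg.sub {κ : Type} [Fintype κ] {f g : (κ → ℝ) → ℝ} (hf : IsReg f) (hg : IsReg g) :
    IsReg (fun t => f t - g t) := by
  simpa [sub_eq_add_neg] using hf.add hg.neg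

theorem IsReg.const {κ : Type} [Fintype κ] (c : ℝ) : IsReg (fun _ : κ → ℝ => c) := by
  refine ⟨algebraMap ℝ (AnRing κ) c, rfl, ?_⟩
  exact isAlgebraic_algebraMap
    (algebraMap ℝ (Algebra.adjoin ℝ (Set.range (AnRing.x : κ → AnRing κ))) c)

theorem IsReg.coord {κ : Type} [Fintype κ] (i : κ) : IsReg (fun t : κ → ℝ => t i) := by
  refine ⟨AnRing.x i, rfl, ?_⟩
  exact isAlgebraic_algebraMap
    (⟨AnRing.x i, Algebra.subset_adjoin ⟨i, rfl⟩⟩ : Algebra.adjoin ℝ (Set.range AnRing.x))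

theorem IsReg.inv {κ : Type} [Fintype κ] {f : (κ → ℝ) → ℝ} (hf : IsReg f) (h0 : ∀ t, f t ≠ 0) :
    IsReg (fun t => (f t)⁻¹) := by
  obtain ⟨a, rfl, ha⟩ := hf
  let b : AnRing κ := ⟨fun t => (a.1 t)⁻¹, fun t ht => (AnRing.an a t ht).inv (h0 t)⟩
  let _ : Invertible a := ⟨b, Subtype.ext (funext fun t => inv_mul_cancel₀ (h0 t)),
    Subtype.ext (funext fun t => mul_inv_cancel₀ (h0 t))⟩
  exact ⟨b, rfl, ha.invOf⟩

theorem IsReg.continuous {κ : Type} [Fintype κ] {f : (κ → ℝ) → ℝ} (hf : IsReg f) :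
    Continuous f := by
  obtain ⟨a, rfl, ha⟩ := hf
  exact continuous_iff_continuousAt.2 fun t => (AnRing.diff a t).continuousAt

/-- Complex-valued regular functions. -/
def IsCReg {κ : Type} [Fintype κ] (g : (κ → ℝ) → ℂ) : Prop :=
  IsReg (fun t => (g t).re) ∧ IsReg (fun t => (g t).im)

theorem IsCReg.add {κ : Type} [Fintype κ] {f g : (κ → ℝ) → ℂ} (hf : IsCReg f) (hg : IsCReg g) :
    IsCReg (fun t => f t + g t) := by
  constructor
  · simpa using hf.1.add hg.1
  · simpa using hf.2.add hg.2

theorem IsCReg.neg {κ : Type} [Fintype κ] {f : (κ → ℝ) → ℂ} (hf : IsCReg f) :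
    IsCReg (fun t => - f t) := by
  constructor
  · simpa using hf.1.neg
  · simpa using hf.2.neg

theorem IsCReg.sub {κ : Type} [Fintype κ] {f g : (κ → ℝ) → ℂ} (hf : IsCReg f) (hg : IsCReg g) :
    IsCReg (fun t => f t - g t) := by
  simpa [sub_eq_add_neg] using hf.add hg.neg

theorem IsCReg.mul {κ : Type} [Fintype κ] {f g : (κ → ℝ) → ℂ} (hf : IsCReg f) (hg : IsCReg g) :
    IsCReg (fun t => f t * g t) := by
  constructor
  · simpa using (hf.1.mul hg.1).sub (hf.2.mul hg.2)
  · simpa using (hf.1.mul hg.2).add (hf.2.mul hg.1)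

theorem IsCReg.const {κ : Type} [Fintype κ] (c : ℂ) : IsCReg (fun _ : κ → ℝ => c) :=
  ⟨IsReg.const _, IsReg.const _⟩

theorem IsCReg.star {κ : Type} [Fintype κ] {f : (κ → ℝ) → ℂ} (hf : IsCReg f) :
    IsCReg (fun t => star (f t)) := by
  constructor
  · simpa using hf.1
  · simpa using hf.2.neg

theorem IsCReg.inv {κ : Type} [Fintype κ] {f : (κ → ℝ) → ℂ} (hf : IsCReg f)
    (h0 : ∀ t, f t ≠ 0) : IsCReg (fun t => (f t)⁻¹) := by
  have hn : IsReg (fun t => (Complex.normSq (f t))⁻¹) := by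
    refine IsReg.inv ?_ fun t => (Complex.normSq_pos.2 (h0 t)).ne'
    simpa [Complex.normSq_apply] using (hf.1.mul hf.1).add (hf.2.mul hf.2)
  constructor
  · simpa [Complex.inv_re, div_eq_mul_inv] using hf.1.mul hn
  · simpa [Complex.inv_im, div_eq_mul_inv] using hf.2.neg.mul hn

theorem IsCReg.continuous {κ : Type} [Fintype κ] {f : (κ → ℝ) → ℂ} (hf : IsCReg f) :
    Continuous f := by
  have h1 : f = fun t => (((f t).re : ℝ) : ℂ) + ((f t).im : ℝ) * Complex.I := by
    funext t; exact (Complex.re_add_im _).symm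
  rw [h1]
  exact (Complex.continuous_ofReal.comp hf.1.continuous).add
    ((Complex.continuous_ofReal.comp hf.2.continuous).mul continuous_const)

theorem IsCReg.sum {κ α : Type} [Fintype κ] {f : α → (κ → ℝ) → ℂ} (s : Finset α)
    (hf : ∀ a, IsCReg (f a)) : IsCReg (fun t => ∑ a ∈ s, f a t) := by
  induction s using Finset.induction_on with
  | empty => simpa using IsCReg.const 0
  | insert a s ha ih => simpa [Finset.sum_insert ha] using (hf a).add ih

theorem IsCReg.prod {κ α : Type} [Fintype κ] {f : α → (κ → ℝ) → ℂ} (s : Finset α)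
    (hf : ∀ a, IsCReg (f a)) : IsCReg (fun t => ∏ a ∈ s, f a t) := by
  induction s using Finset.induction_on with
  | empty => simpa using IsCReg.const 1
  | insert a s ha ih => simpa [Finset.prod_insert ha] using (hf a).mul ih

/-- Matrix-valued regular functions. -/
def IsMReg {κ m : Type} [Fintype κ] (g : (κ → ℝ) → Matrix m m ℂ) : Prop :=
  ∀ i j, IsCReg (fun t => g t i j)

theorem IsMReg.mul {κ m : Type} [Fintype κ] [Fintype m] {f g : (κ → ℝ) → Matrix m m ℂ}
    (hf : IsMReg f) (hg : IsMReg g) : IsMReg (fun t => f t * g t) := by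
  intro i j
  simp only [Matrix.mul_apply]
  exact IsCReg.sum _ fun a => (hf i a).mul (hg a j)

theorem IsMReg.add {κ m : Type} [Fintype κ] {f g : (κ → ℝ) → Matrix m m ℂ}
    (hf : IsMReg f) (hg : IsMReg g) : IsMReg (fun t => f t + g t) :=
  fun i j => (hf i j).add (hg i j)

theorem IsMReg.sub {κ m : Type} [Fintype κ] {f g : (κ → ℝ) → Matrix m m ℂ}
    (hf : IsMReg f) (hg : IsMReg g) : IsMReg (fun t => f t - g t) :=
  fun i j => (hf i j).sub (hg i j)

theorem IsMReg.const {κ m : Type} [Fintype κ] (c : Matrix m m ℂ) :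
    IsMReg (fun _ : κ → ℝ => c) := fun _ _ => IsCReg.const _

theorem IsMReg.conjTranspose {κ m : Type} [Fintype κ] {f : (κ → ℝ) → Matrix m m ℂ}
    (hf : IsMReg f) : IsMReg (fun t => (f t)ᴴ) := fun i j => (hf j i).star

theorem IsMReg.det {κ m : Type} [Fintype κ] [Fintype m] [DecidableEq m]
    {f : (κ → ℝ) → Matrix m m ℂ} (hf : IsMReg f) : IsCReg (fun t => (f t).det) := by
  simp only [Matrix.det_apply']
  exact IsCReg.sum _ fun σ => (IsCReg.const _).mul (IsCReg.prod _ fun i => hf _ _)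

theorem IsMReg.inv {κ m : Type} [Fintype κ] [Fintype m] [DecidableEq m]
    {f : (κ → ℝ) → Matrix m m ℂ} (hf : IsMReg f) (h0 : ∀ t, (f t).det ≠ 0) :
    IsMReg (fun t => (f t)⁻¹) := by
  intro i j
  simp only [Matrix.inv_def, Matrix.smul_apply, smul_eq_mul, Ring.inverse_eq_inv',
    Matrix.adjugate_apply]
  refine (hf.det.inv h0).mul (IsMReg.det fun a b => ?_)
  by_cases h : a = j
  · subst h
    simpa using IsCReg.const _
  · simpa [h] using hf a b

theorem IsMReg.list_prod {κ m : Type} [Fintype κ] [Fintype m] [DecidableEq m]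
    (l : List ((κ → ℝ) → Matrix m m ℂ)) (hl : ∀ f ∈ l, IsMReg f) :
    IsMReg (fun t => (l.map fun f => f t).prod) := by
  induction l with
  | nil => simpa using IsMReg.const 1
  | cons f l ih =>
    simpa using (hl f (by simp)).mul (ih fun g hg => hl g (by simp [hg]))

theorem IsMReg.continuous {κ m : Type} [Fintype κ] {f : (κ → ℝ) → Matrix m m ℂ}
    (hf : IsMReg f) : Continuous f :=
  continuous_matrix fun i j => (hf i j).continuous

end Aux4

section Aux5
open Topology Filter

/-- Cayley transform. -/
noncomputable def cay (A : Matrix (Fin 4) (Fin 4) ℂ) : Matrix (Fin 4) (Fin 4) ℂ :=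
  (1 - A) * (1 + A)⁻¹

theorem cay_det {A : Matrix (Fin 4) (Fin 4) ℂ} (hA : Aᴴ = -A) : (1 + A).det ≠ 0 := by
  have h1 : (1 - A) * (1 + A) = 1 + Aᴴ * A := by
    rw [hA]; noncomm_ring
  have h2 : (1 + Aᴴ * A).PosDef :=
    Matrix.PosDef.one.add_posSemidef (Matrix.posSemidef_conjTranspose_mul_self A)
  have h3 := h2.det_pos.ne'
  rw [← h1, Matrix.det_mul] at h3
  exact right_ne_zero_of_mul h3

theorem cay_unitary {A : Matrix (Fin 4) (Fin 4) ℂ} (hA : Aᴴ = -A) :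
    cay A ∈ Matrix.unitaryGroup (Fin 4) ℂ := by
  rw [Matrix.mem_unitaryGroup_iff', Matrix.star_eq_conjTranspose]
  have hd := cay_det hA
  have hd' : (1 - A).det ≠ 0 := by
    have := cay_det (A := -A) (by simp [hA])
    simpa [sub_eq_add_neg] using this
  have h1 : (1 + A)ᴴ = 1 - A := by simp [hA, sub_eq_add_neg]
  have h2 : (1 - A)ᴴ = 1 + A := by simp [hA, sub_eq_add_neg]
  rw [cay, Matrix.conjTranspose_mul, Matrix.conjTranspose_nonsing_inv, h1, h2]
  have hc : (1 + A) * (1 - A) = (1 - A) * (1 + A) := by noncomm_ring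
  calc (1 - A)⁻¹ * (1 + A) * ((1 - A) * (1 + A)⁻¹)
      = (1 - A)⁻¹ * ((1 + A) * (1 - A)) * (1 + A)⁻¹ := by noncomm_ring
    _ = ((1 - A)⁻¹ * (1 - A)) * ((1 + A) * (1 + A)⁻¹) := by rw [hc]; noncomm_ring
    _ = 1 := by
      rw [Matrix.nonsing_inv_mul _ hd'.isUnit, Matrix.mul_nonsing_inv _ hd.isUnit, one_mul]

theorem cay_surj {w : Matrix (Fin 4) (Fin 4) ℂ} (hw : w ∈ Matrix.unitaryGroup (Fin 4) ℂ)
    (hd : (1 + w).det ≠ 0) : ∃ A, Aᴴ = -A ∧ cay A = w := by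
  have hu : wᴴ * w = 1 := (Matrix.mem_unitaryGroup_iff').1 hw
  have hA : ((1 - w) * (1 + w)⁻¹) * (1 + w) = 1 - w := by
    rw [Matrix.mul_assoc, Matrix.nonsing_inv_mul _ hd.isUnit, mul_one]
  have hdH : (1 + wᴴ).det ≠ 0 := by
    have : (1 + wᴴ) = (1 + w)ᴴ := by simp
    rw [this, Matrix.det_conjTranspose]
    simpa using hd
  set A := (1 - w) * (1 + w)⁻¹ with hAdef
  have hcr : ∀ X Y : Matrix (Fin 4) (Fin 4) ℂ, X * (1 + w) = Y * (1 + w) → X = Y := by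
    intro X Y h
    have := congrArg (· * (1 + w)⁻¹) h
    simpa [Matrix.mul_assoc, Matrix.mul_nonsing_inv _ hd.isUnit] using this
  have hcl : ∀ X Y : Matrix (Fin 4) (Fin 4) ℂ, (1 + wᴴ) * X = (1 + wᴴ) * Y → X = Y := by
    intro X Y h
    have := congrArg ((1 + wᴴ)⁻¹ * ·) h
    simpa [← Matrix.mul_assoc, Matrix.nonsing_inv_mul _ hdH.isUnit] using this
  have hAH : (1 + wᴴ) * Aᴴ = 1 - wᴴ := by
    have := congrArg Matrix.conjTranspose hA
    simpa using this
  have hsk : Aᴴ = -A := by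
    apply hcl
    apply hcr
    rw [hAH, Matrix.mul_assoc, neg_mul, hA]
    simp only [mul_add, sub_mul, add_mul, mul_neg, mul_sub, mul_one, one_mul, hu]
    abel
  refine ⟨A, hsk, ?_⟩
  have h1 : 1 - A = w * (1 + A) := by
    apply hcr
    rw [Matrix.mul_assoc, sub_mul, add_mul, hA]
    noncomm_ring
  rw [cay, h1, Matrix.mul_assoc, Matrix.mul_nonsing_inv _ (cay_det hsk).isUnit, mul_one]

/-- Determinant correction. -/
noncomputable def fixDet (w : Matrix (Fin 4) (Fin 4) ℂ) : Matrix (Fin 4) (Fin 4) ℂ :=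
  w * Matrix.diagonal (fun i => if i = 0 then star w.det else 1)

theorem fixDet_mem {w : Matrix (Fin 4) (Fin 4) ℂ} (hw : w ∈ Matrix.unitaryGroup (Fin 4) ℂ) :
    fixDet w ∈ Matrix.specialUnitaryGroup (Fin 4) ℂ := by
  have hd : w.det * star w.det = 1 := (Unitary.mem_iff.1 (Matrix.det_of_mem_unitary hw)).2
  have hd' : star w.det * w.det = 1 := by rw [mul_comm]; exact hd
  rw [Matrix.mem_specialUnitaryGroup_iff]
  constructor
  · refine mul_mem hw ?_
    rw [Matrix.mem_unitaryGroup_iff, Matrix.star_eq_conjTranspose, Matrix.diagonal_conjTranspose,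
      Matrix.diagonal_mul_diagonal, ← Matrix.diagonal_one]
    congr 1
    funext i
    by_cases h : i = 0
    · simpa [h] using hd'
    · simp [h]
  · rw [fixDet, Matrix.det_mul, Matrix.det_diagonal]
    simpa using hd

theorem fixDet_eq {w : Matrix (Fin 4) (Fin 4) ℂ} (hw : w.det = 1) : fixDet w = w := by
  simp [fixDet, hw]

theorem fixDet_continuous : Continuous fixDet := by
  unfold fixDet
  refine continuous_id.matrix_mul (Continuous.matrix_diagonal ?_)
  refine continuous_pi fun i => ?_
  by_cases h : i = 0
  · simp only [h, if_true]
    exact continuous_id.matrix_det.star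
  · simp only [h, if_false]
    exact continuous_const

/-- Cayley type parametrization of `SU(4)` by arbitrary matrices. -/
noncomputable def suParam (B : Matrix (Fin 4) (Fin 4) ℂ) : SU4 :=
  ⟨fixDet (cay (B - Bᴴ)), fixDet_mem (cay_unitary (by simp))⟩

theorem suParam_dense : DenseRange suParam := by
  intro v
  have hvu := (Matrix.mem_specialUnitaryGroup_iff.1 v.2).1
  have hvd := (Matrix.mem_specialUnitaryGroup_iff.1 v.2).2
  have hz : ∀ θ : ℝ, ‖Complex.exp (θ * Complex.I)‖ = 1 := Complex.norm_exp_ofReal_mul_I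
  have hz0 : ∀ θ : ℝ, Complex.exp (θ * Complex.I) ≠ 0 := fun θ => Complex.exp_ne_zero _
  have hW : ∀ θ : ℝ, (Complex.exp (θ * Complex.I))⁻¹ • v.1 ∈ Matrix.unitaryGroup (Fin 4) ℂ := by
    intro θ
    rw [Matrix.mem_unitaryGroup_iff, star_smul, smul_mul_smul_comm, Matrix.mem_unitaryGroup_iff.1 hvu]
    have : (Complex.exp (θ * Complex.I))⁻¹ * star (Complex.exp (θ * Complex.I))⁻¹ = 1 := by
      rw [Complex.star_def, Complex.mul_conj, Complex.normSq_eq_norm_sq]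
      simp [hz θ]
    rw [this, one_smul]
  let Γ : ℝ → SU4 := fun θ => ⟨fixDet ((Complex.exp (θ * Complex.I))⁻¹ • v.1), fixDet_mem (hW θ)⟩
  have hΓc : Continuous Γ := by
    refine Continuous.subtype_mk (fixDet_continuous.comp ?_) _
    have : Continuous fun θ : ℝ => (Complex.exp (θ * Complex.I))⁻¹ :=
      Continuous.inv₀ (by fun_prop) hz0
    exact this.smul continuous_const
  have hΓ0 : Γ 0 = v := by
    apply Subtype.ext
    simp [Γ, fixDet_eq hvd]
  have hlim : Tendsto Γ (𝓝[≠] 0) (𝓝 v) := by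
    rw [← hΓ0]
    exact (hΓc.tendsto 0).mono_left nhdsWithin_le_nhds
  refine mem_closure_of_tendsto hlim ?_
  have hder : HasDerivAt (fun θ : ℝ => Complex.exp (θ * Complex.I)) (Complex.I) 0 := by
    have h1 : HasDerivAt (fun θ : ℝ => (θ : ℂ) * Complex.I) (1 * Complex.I) 0 :=
      (Complex.ofRealCLM.hasDerivAt (x := (0:ℝ))).mul_const Complex.I
    simpa using h1.cexp
  have hne := hder.tendsto_nhdsNE Complex.I_ne_zero
  have hfin : ((-v.1).charpoly.roots.toFinset : Set ℂ).Finite := Finset.finite_toSet _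
  have hev : ∀ᶠ z in 𝓝[≠] (Complex.exp (((0:ℝ):ℂ) * Complex.I)),
      z ∉ ((-v.1).charpoly.roots.toFinset : Set ℂ) :=
    by
      rw [eventually_nhdsWithin_iff]
      have hcl : IsClosed (((-v.1).charpoly.roots.toFinset : Set ℂ) \
          {Complex.exp (((0:ℝ):ℂ) * Complex.I)}) := (hfin.subset Set.sdiff_subset).isClosed
      filter_upwards [hcl.isOpen_compl.mem_nhds (fun h => h.2 rfl)] with z hz hz1 hz2
      exact hz ⟨hz2, hz1⟩
  filter_upwards [hne.eventually hev] with θ hθ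
  have hdet : (1 + (Complex.exp (θ * Complex.I))⁻¹ • v.1).det ≠ 0 := by
    intro h0
    apply hθ
    simp only [Finset.mem_coe, Multiset.mem_toFinset]
    rw [Polynomial.mem_roots (Matrix.charpoly_monic _).ne_zero, Polynomial.IsRoot.def,
      Matrix.eval_charpoly]
    have : Matrix.scalar (Fin 4) (Complex.exp (θ * Complex.I)) - -v.1 =
        Complex.exp (θ * Complex.I) • (1 + (Complex.exp (θ * Complex.I))⁻¹ • v.1) := by
      rw [smul_add, smul_smul, mul_inv_cancel₀ (hz0 θ), one_smul, sub_neg_eq_add,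
        Matrix.scalar_apply, Matrix.smul_one_eq_diagonal]
    rw [this, Matrix.det_smul, h0, mul_zero]
  obtain ⟨A, hA, hc⟩ := cay_surj (hW θ) hdet
  refine ⟨(1/2 : ℂ) • A, Subtype.ext ?_⟩
  have h2 : (1/2 : ℂ) • A - ((1/2 : ℂ) • A)ᴴ = A := by
    rw [Matrix.conjTranspose_smul, hA, smul_neg, sub_neg_eq_add]
    have : star (1/2 : ℂ) = 1/2 := by simp
    rw [this, ← add_smul]
    norm_num
  simp only [suParam, h2, hc, Γ]

/-- Parameter index type. -/
abbrev PIdx (R : ℕ) := Fin R × Fin 4 × Fin 4 × Bool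

/-- The matrix of parameters of gate `r`. -/
def pMat {R : ℕ} (t : PIdx R → ℝ) (r : Fin R) : Matrix (Fin 4) (Fin 4) ℂ :=
  Matrix.of fun i j => ⟨t (r, i, j, true), t (r, i, j, false)⟩

/-- The parametrization of the gate tuples. -/
noncomputable def phi {R : ℕ} (t : PIdx R → ℝ) (r : Fin R) : SU4 := suParam (pMat t r)

theorem phi_dense {R : ℕ} : DenseRange (phi : (PIdx R → ℝ) → Fin R → SU4) := by
  have h1 : DenseRange (Pi.map fun _ : Fin R => suParam) := DenseRange.piMap fun _ => suParam_dense
  refine h1.mono ?_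
  rintro _ ⟨B, rfl⟩
  refine ⟨fun k => if k.2.2.2 then (B k.1 k.2.1 k.2.2.1).re else (B k.1 k.2.1 k.2.2.1).im, ?_⟩
  funext r
  simp only [phi, Pi.map]
  congr 1

theorem phi_reg {R : ℕ} (r : Fin R) :
    IsMReg (fun t : PIdx R → ℝ => (phi t r : Matrix (Fin 4) (Fin 4) ℂ)) := by
  have hB : IsMReg (fun t : PIdx R → ℝ => pMat t r) := fun i j =>
    ⟨IsReg.coord (r, i, j, true), IsReg.coord (r, i, j, false)⟩
  have hA := hB.sub hB.conjTranspose
  have hcay : IsMReg (fun t : PIdx R → ℝ => cay (pMat t r - (pMat t r)ᴴ)) :=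
    ((IsMReg.const 1).sub hA).mul
      (((IsMReg.const 1).add hA).inv fun t => cay_det (by simp))
  refine hcay.mul fun i j => ?_
  simp only [Matrix.diagonal_apply]
  by_cases h : i = j
  · by_cases h0 : i = 0
    · simp only [h0, ← h, if_true]
      exact hcay.det.star
    · simp only [h0, ← h, if_true, if_false]
      exact IsCReg.const 1
  · simp only [h, if_false]
    exact IsCReg.const 0

theorem phi_continuous {R : ℕ} : Continuous (phi : (PIdx R → ℝ) → Fin R → SU4) :=
  continuous_pi fun r => Continuous.subtype_mk (phi_reg r).continuous _

end Aux5

section Aux6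
open Topology Filter

/-- Real coordinates on a complex Euclidean space. -/
noncomputable def realCoord (J : Type) [Fintype J] : EuclideanSpace ℂ J ≃ₗ[ℝ] (J × Bool → ℝ) where
  toFun y k := if k.2 then (y k.1).re else (y k.1).im
  map_add' a b := by
    funext k
    by_cases h : k.2 <;> simp [h]
  map_smul' c a := by
    funext k
    by_cases h : k.2 <;> simp [h]
  invFun w := WithLp.toLp 2 fun p => ⟨w (p, true), w (p, false)⟩
  left_inv y := by
    ext p
    simp
  right_inv w := by
    funext ⟨p, b⟩
    cases b <;> simp

/-- Real coordinates of a matrix. -/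
noncomputable def matCoord {n : ℕ} (M : NMatrix n) :
    ((QubitBasis n × QubitBasis n) × Bool → ℝ) := realCoord _ (toEuc M)

theorem matCoord_inj {n : ℕ} {M N : NMatrix n} (h : matCoord M = matCoord N) : M = N := by
  have h1 := (realCoord _).injective h
  ext a b
  exact congrArg (fun y : EuclideanSpace ℂ (QubitBasis n × QubitBasis n) => y (a, b)) h1

theorem matCoord_dimH {n : ℕ} (S : Set (NMatrix n)) :
    dimH (matCoord '' S) = dimH (toEuc '' S) := by
  have h := (realCoord (QubitBasis n × QubitBasis n)).toContinuousLinearEquiv.dimH_image (toEuc '' S)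
  rw [Set.image_image] at h
  exact h

theorem matCoord_continuous {n : ℕ} : Continuous (matCoord : NMatrix n → _) := by
  refine continuous_pi fun k => ?_
  by_cases hk : k.2
  · have : (fun M : NMatrix n => matCoord M k) = fun M => (M k.1.1 k.1.2).re := by
      funext M; simp [matCoord, realCoord, toEuc, hk]
    rw [this]
    exact Complex.continuous_re.comp (continuous_id.matrix_elem _ _)
  · have : (fun M : NMatrix n => matCoord M k) = fun M => (M k.1.1 k.1.2).im := by
      funext M; simp [matCoord, realCoord, toEuc, hk]
    rw [this]
    exact Complex.continuous_im.comp (continuous_id.matrix_elem _ _)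

theorem IsMReg.matCoord {κ : Type} [Fintype κ] {n : ℕ} {f : (κ → ℝ) → NMatrix n}
    (hf : IsMReg f) (k : (QubitBasis n × QubitBasis n) × Bool) :
    IsReg (fun t => matCoord (f t) k) := by
  by_cases hk : k.2
  · simpa [_root_.matCoord, realCoord, toEuc, hk] using (hf k.1.1 k.1.2).1
  · simpa [_root_.matCoord, realCoord, toEuc, hk] using (hf k.1.1 k.1.2).2

theorem IsMReg.embedGate {κ : Type} [Fintype κ] {n : ℕ} (p : Fin n × Fin n)
    {f : (κ → ℝ) → Matrix (Fin 4) (Fin 4) ℂ} (hf : IsMReg f) :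
    IsMReg (fun t => embedGate p (f t)) := by
  intro a b
  by_cases h : ∀ i, i ≠ p.1 → i ≠ p.2 → a i = b i
  · simp only [_root_.embedGate, if_pos h]
    exact hf _ _
  · simp only [_root_.embedGate, if_neg h]
    exact IsCReg.const 0

theorem contract_reg {κ : Type} [Fintype κ] {n R : ℕ} (A : Architecture n R)
    (x : (κ → ℝ) → Fin R → SU4)
    (hx : ∀ r, IsMReg (fun t => (x t r : Matrix (Fin 4) (Fin 4) ℂ))) :
    IsMReg (fun t => contract A (x t)) := by
  have h := IsMReg.list_prod
    (List.ofFn fun i : Fin R => fun t => embedGate (A i).1 (x t i : Matrix (Fin 4) (Fin 4) ℂ)).reverse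
    (by
      intro f hf
      rw [List.mem_reverse, List.mem_ofFn] at hf
      obtain ⟨i, rfl⟩ := hf
      exact (hx i).embedGate _)
  simpa [List.map_reverse, List.map_ofFn, contract, gateList, Function.comp_def] using h

theorem embedGate_continuous {n : ℕ} (p : Fin n × Fin n) :
    Continuous (embedGate p : Matrix (Fin 4) (Fin 4) ℂ → NMatrix n) := by
  refine continuous_matrix fun a b => ?_
  by_cases h : ∀ i, i ≠ p.1 → i ≠ p.2 → a i = b i
  · simp only [embedGate, if_pos h]
    exact continuous_id.matrix_elem _ _
  · simp only [embedGate, if_neg h]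
    exact continuous_const

theorem contract_continuous {n R : ℕ} (A : Architecture n R) : Continuous (contract A) := by
  have h := continuous_list_prod (ι := Fin R)
    (f := fun i (x : Fin R → SU4) => embedGate (A i).1 (x i : Matrix (Fin 4) (Fin 4) ℂ))
    (List.finRange R).reverse (fun i _ => (embedGate_continuous _).comp
      (continuous_subtype_val.comp (continuous_apply i)))
  convert! h using 2 with x
  rw [contract, gateList, List.ofFn_eq_map, List.map_reverse]

theorem null_translate {n R R' : ℕ} (A : Architecture n R) (A' : Architecture n R')
    (hdim : accessibleDim A' < accessibleDim A) (h : Fin R → SU4) :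
    volume {t : PIdx R → ℝ | ∃ y, contract A' y = contract A (phi t * h)} = 0 := by
  have hreg : IsMReg (fun t : PIdx R → ℝ => contract A (phi t * h)) :=
    contract_reg A _ fun r => (phi_reg r).mul (IsMReg.const (h r).1)
  choose f hf1 hf2 using fun k => hreg.matCoord k
  have hfe : ∀ t, (fun k => (f k).1 t) = matCoord (contract A (phi t * h)) := fun t => by
    funext k
    rw [hf1]
  have hd : DenseRange (fun t : PIdx R → ℝ => phi t * h) :=
    (Homeomorph.mulRight h).surjective.denseRange.comp phi_dense (Homeomorph.mulRight h).continuous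
  have hsub : matCoord '' Set.range (contract A) ⊆
      closure (Set.range fun (t : PIdx R → ℝ) k => (f k).1 t) := by
    have h1 := (matCoord_continuous.comp (contract_continuous A)).range_subset_closure_image_dense hd
    rw [← Set.range_comp] at h1
    rw [← Set.range_comp]
    convert! h1 using 3
    funext t
    exact hfe t
  have := AnRing.main f hf2 (matCoord '' Set.range (contract A')) (by
    rw [matCoord_dimH]
    refine lt_of_lt_of_le hdim ?_
    rw [accessibleDim, ← matCoord_dimH]
    exact dimH_mono hsub)
  refine measure_mono_null ?_ this
  rintro t ⟨y, hy⟩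
  exact ⟨_, ⟨y, hy⟩, (hfe t).symm⟩

theorem final_null {n R R' : ℕ} (A : Architecture n R) (A' : Architecture n R')
    (hdim : accessibleDim A' < accessibleDim A) :
    muSU4 R {x : Fin R → SU4 | ∃ y : Fin R' → SU4, contract A' y = contract A x} = 0 := by
  set E := {x : Fin R → SU4 | ∃ y : Fin R' → SU4, contract A' y = contract A x} with hE
  have hEc : IsClosed E :=
    (isCompact_range (contract_continuous A')).isClosed.preimage (contract_continuous A)
  have : SecondCountableTopology (Matrix (Fin 4) (Fin 4) ℂ) :=
    inferInstanceAs (SecondCountableTopology (Fin 4 → Fin 4 → ℂ))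
  have : SecondCountableTopology SU4 :=
    TopologicalSpace.Subtype.secondCountableTopology _
  have hinv : haarSU4.IsMulLeftInvariant := by unfold haarSU4; infer_instance
  have hpm : IsProbabilityMeasure (muSU4 R) := by unfold muSU4; infer_instance
  have hinv2 : (muSU4 R).IsMulLeftInvariant := by unfold muSU4; infer_instance
  have hT : MeasurableSet {p : (Fin R → SU4) × (PIdx R → ℝ) | phi p.2 * p.1 ∈ E} :=
    (hEc.preimage ((phi_continuous.comp continuous_snd).mul continuous_fst)).measurableSet
  have h1 : ((muSU4 R).prod volume) {p : (Fin R → SU4) × (PIdx R → ℝ) | phi p.2 * p.1 ∈ E} = 0 := by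
    rw [Measure.measure_prod_null hT]
    exact Filter.Eventually.of_forall fun h => null_translate A A' hdim h
  have h2 := Measure.measure_ae_null_of_prod_null (μ := (volume : Measure (PIdx R → ℝ)))
    (ν := muSU4 R) (s := Prod.swap ⁻¹' {p | phi p.2 * p.1 ∈ E}) (by
      rw [← Measure.prod_swap, Measure.map_apply measurable_swap (measurable_swap hT)]
      exact h1)
  obtain ⟨t, ht⟩ := h2.exists
  have h3 := measure_preimage_mul (muSU4 R) (phi t) E
  rw [← h3]
  exact ht

end Aux6
/-! ## Statement 11: smaller accessible dimension implies measure zero -/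

/-- **Unitaries of a lower-dimensional architecture are hit with probability zero.**
Let `A` and `A'` be `n`-qubit architectures with `R` and `R'` gates respectively.  If the
accessible dimensions satisfy `d_{A'} < d_A`, then a Haar-random architecture-`A` circuit
implements a unitary implementable with `A'` with probability zero. -/
theorem measure_zero_of_lower_accessible_dimension
    (n R R' : ℕ) (hn : 2 ≤ n)
    (A : Architecture n R) (A' : Architecture n R')
    (h : accessibleDim A' < accessibleDim A) :
    muSU4 R {x : Fin R → SU4 | ∃ y : Fin R' → SU4, contract A' y = contract A x} = 0 := by
  exact final_null A A' h
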